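/- There exists a universal constant C > 0 such that for every number of arms k ≥ 1, every horizon n ≥ 1, and every prior probability distribution Q over k-armed bandit environments (where an environment is a vector θ ∈ [0,1]^k of mean rewards and, when arm a is played, the observed reward is θ(a) plus an independent standard Gaussian noise term), there exists a policy whose Bayesian regret satisfies BR*_n(Q) ≤ C·√(k·n). -/

import Mathlib

open MeasureTheory ProbabilityTheory

namespace Bandit

/-- History of `t` rounds of interaction: the arm played and the reward observed
in each of the `t` rounds. -/
abbrev Hist (k t : ℕ) := Fin t → Fin k × ℝ

/-- A (possibly randomized, measurable) policy for a `k`-armed bandit: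
at each round `t`, given the history of previously selected arms and observed rewards,
it selects the next arm according to a probability distribution, measurably in the history. -/
structure Policy (k : ℕ) where
  act : ∀ t : ℕ, Hist k t → Measure (Fin k)
  measurable_act : ∀ t, Measurable (act t)
  prob_act : ∀ t h, IsProbabilityMeasure (act t h)

/-- The distribution of the history after `t` rounds of interaction between the
action rule `act` and the bandit environment with mean-reward vector `θ`, where the
reward observed upon playing arm `a` is `θ a` plus independent standard Gaussian noise. -/
noncomputable def traj {k : ℕ} (θ : Fin k → ℝ) (act : ∀ t : ℕ, Hist k t → Measure (Fin k)) :
    ∀ t : ℕ, Measure (Hist k t)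
  | 0 => Measure.dirac Fin.elim0
  | t + 1 =>
      (traj θ act t).bind fun h =>
        (act t h).bind fun a =>
          (gaussianReal (θ a) 1).map fun r => Fin.snoc h (a, r)

/-- The Bayesian `n`-round regret of the action rule `act` under the prior `Q` on
environments: the expectation, over `θ ∼ Q` and over the interaction (the Gaussian
noise and the policy's internal randomization), of the sum over the `n` rounds of the
gap between the best mean reward and the mean reward of the selected arm. -/
noncomputable def bayesRegret (k n : ℕ) (Q : Measure (Fin k → ℝ))
    (act : ∀ t : ℕ, Hist k t → Measure (Fin k)) : ℝ :=
  ∫ θ, (∫ h, (∑ t : Fin n, ((⨆ a, θ a) - θ (h t).1)) ∂(traj θ act n)) ∂Q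

end Bandit

namespace Bandit

/-- Probability vectors on `k` arms, parametrized by the inverse square roots of the weights. -/
def InvSqrtSimplex (k : ℕ) : Type :=
  {x : Fin k → ℝ // (∀ b, 1 ≤ x b) ∧ ∑ b, 1 / x b ^ 2 = 1}

/-- Up to an additive constant, the Bregman divergence of the `1/2`-Tsallis entropy from the
vertex `i` of the simplex to the distribution with weights `1 / x b ^ 2`. -/
noncomputable def potential {k : ℕ} (i : Fin k) (x : InvSqrtSimplex k) : ℝ :=
  ∑ b, 1 / x.1 b + x.1 i

lemma InvSqrtSimplex.pos {k : ℕ} (x : InvSqrtSimplex k) (b : Fin k) : 0 < x.1 b :=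
  lt_of_lt_of_le one_pos (x.2.1 b)

lemma potential_nonneg {k : ℕ} (i : Fin k) (x : InvSqrtSimplex k) : 0 ≤ potential i x :=
  add_nonneg (Finset.sum_nonneg fun b _ => (one_div_pos.2 (x.pos b)).le) (x.pos i).le

lemma sum_one_div_le_sqrt {k : ℕ} (x : InvSqrtSimplex k) : ∑ b, 1 / x.1 b ≤ √(k : ℝ) := by
  apply Real.le_sqrt_of_sq_le
  have h := sq_sum_le_card_mul_sum_sq (s := Finset.univ) (f := fun b => 1 / x.1 b)
  simpa only [div_pow, one_pow, x.2.2, Finset.card_univ, Fintype.card_fin, mul_one] using h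

/-- The uniform distribution. -/
noncomputable def InvSqrtSimplex.uniform {k : ℕ} (hk : 1 ≤ k) : InvSqrtSimplex k :=
  ⟨fun _ => √(k : ℝ), fun _ => Real.one_le_sqrt.2 (by exact_mod_cast hk), by
    have : (k : ℝ) ≠ 0 := by positivity
    simp [this]⟩

lemma potential_uniform {k : ℕ} (hk : 1 ≤ k) (i : Fin k) :
    potential i (InvSqrtSimplex.uniform hk) ≤ 2 * √(k : ℝ) := by
  have h := sum_one_div_le_sqrt (InvSqrtSimplex.uniform hk)
  have h' : (InvSqrtSimplex.uniform hk).1 i = √(k : ℝ) := rfl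
  unfold potential
  linarith

lemma exists_shift_sum_eq_one {k : ℕ} (hk : 1 ≤ k) (y : Fin k → ℝ) (hy : ∀ b, 1 ≤ y b)
    (hsum : ∑ b, 1 / y b ^ 2 ≤ 1) :
    ∃ l : ℝ, 0 ≤ l ∧ (∀ b, 1 ≤ y b - l) ∧ ∑ b, 1 / (y b - l) ^ 2 = 1 := by
  have : Nonempty (Fin k) := ⟨⟨0, hk⟩⟩
  obtain ⟨b₀, hb₀⟩ := Finite.exists_min y
  have hcont : ContinuousOn (fun l : ℝ => ∑ b, 1 / (y b - l) ^ 2) (Set.Icc 0 (y b₀ - 1)) := by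
    refine continuousOn_finsetSum _ fun b _ => ?_
    refine ContinuousOn.div (by fun_prop) (by fun_prop) fun l hl => ?_
    have : 0 < y b - l := by linarith [hb₀ b, hl.2]
    positivity
  have hend : 1 ≤ ∑ b, 1 / (y b - (y b₀ - 1)) ^ 2 := by
    have h := Finset.single_le_sum (f := fun b => 1 / (y b - (y b₀ - 1)) ^ 2)
      (fun b _ => by positivity) (Finset.mem_univ b₀)
    simpa using h
  obtain ⟨l, hl, hl1⟩ := intermediate_value_Icc (by linarith [hy b₀]) hcont
    (show (1 : ℝ) ∈ Set.Icc _ _ from ⟨by simpa using hsum, hend⟩)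
  exact ⟨l, hl.1, fun b => by linarith [hb₀ b, hl.2], hl1⟩

lemma exists_mirror_step {k : ℕ} (hk : 1 ≤ k) (x : InvSqrtSimplex k) (a : Fin k) {u : ℝ}
    (hu : 0 ≤ u) :
    ∃ x' : InvSqrtSimplex k, ∀ i, potential i x' ≤
      potential i x - u / x.1 a ^ 2 + (if a = i then u else 0) + u ^ 2 / x.1 a ^ 3 := by
  have hxa := x.pos a
  set y : Fin k → ℝ := fun b => x.1 b + if a = b then u else 0 with hy
  have hxy : ∀ b, x.1 b ≤ y b := fun b => by
    simp only [hy]; split_ifs <;> linarith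
  have hy1 : ∀ b, 1 ≤ y b := fun b => (x.2.1 b).trans (hxy b)
  have hsum : ∑ b, 1 / y b ^ 2 ≤ ∑ b, 1 / x.1 b ^ 2 := Finset.sum_le_sum fun b _ =>
    one_div_le_one_div_of_le (pow_pos (x.pos b) 2) (pow_le_pow_left₀ (x.pos b).le (hxy b) 2)
  obtain ⟨l, hl0, hl, hl1⟩ := exists_shift_sum_eq_one hk y hy1 (hsum.trans_eq x.2.2)
  refine ⟨⟨fun b => y b - l, hl, hl1⟩, fun i => ?_⟩
  have hshift : ∑ b, 1 / (y b - l) ≤ ∑ b, 1 / y b + l := by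
    have : ∑ b, 1 / (y b - l) ≤ ∑ b, (1 / y b + l * (1 / (y b - l) ^ 2)) := by
      refine Finset.sum_le_sum fun b _ => ?_
      have h1 : 0 < y b - l := by linarith [hl b]
      have h2 : 0 < y b := by linarith [hy1 b]
      rw [← sub_nonneg]
      have : 1 / y b + l * (1 / (y b - l) ^ 2) - 1 / (y b - l) =
          l ^ 2 / (y b * (y b - l) ^ 2) := by
        field_simp
        ring
      rw [this]
      positivity
    rwa [Finset.sum_add_distrib, ← Finset.mul_sum, hl1, mul_one] at this
  have hbump : ∑ b, 1 / y b ≤ ∑ b, 1 / x.1 b + (- (u / x.1 a ^ 2) + u ^ 2 / x.1 a ^ 3) := by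
    have : ∑ b, 1 / y b ≤ ∑ b, (1 / x.1 b +
        if a = b then - (u / x.1 a ^ 2) + u ^ 2 / x.1 a ^ 3 else 0) := by
      refine Finset.sum_le_sum fun b _ => ?_
      by_cases hb : a = b
      · subst hb
        simp only [hy, if_true]
        rw [← sub_nonneg]
        have : 1 / x.1 a + (- (u / x.1 a ^ 2) + u ^ 2 / x.1 a ^ 3) - 1 / (x.1 a + u) =
            u ^ 3 / (x.1 a ^ 3 * (x.1 a + u)) := by
          field_simp
          ring
        rw [this]
        positivity
      · simp [hy, hb]
    simpa [Finset.sum_add_distrib] using this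
  simp only [potential]
  have : y i = x.1 i + if a = i then u else 0 := rfl
  linarith

/-- One step of mirror descent with the `1/2`-Tsallis entropy, the loss `ℓ ∈ {0, 1}` of the
played arm `a` being importance weighted. -/
noncomputable def mirrorStep {k : ℕ} (hk : 1 ≤ k) {η : ℝ} (hη : 0 ≤ η) (x : InvSqrtSimplex k)
    (a : Fin k) (ℓ : Bool) : InvSqrtSimplex k :=
  (exists_mirror_step hk x a (u := if ℓ then η * x.1 a ^ 2 else 0)
    (by split_ifs <;> positivity)).choose

lemma potential_mirrorStep {k : ℕ} (hk : 1 ≤ k) {η : ℝ} (hη : 0 ≤ η) (x : InvSqrtSimplex k)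
    (a : Fin k) (ℓ : Bool) (i : Fin k) :
    potential i (mirrorStep hk hη x a ℓ) ≤
      potential i x - (if ℓ then η * x.1 a ^ 2 else 0) / x.1 a ^ 2 +
        (if a = i then if ℓ then η * x.1 a ^ 2 else 0 else 0) +
        (if ℓ then η * x.1 a ^ 2 else 0) ^ 2 / x.1 a ^ 3 :=
  (exists_mirror_step hk x a (u := if ℓ then η * x.1 a ^ 2 else 0)
    (by split_ifs <;> positivity)).choose_spec i

lemma potential_mirrorStep_true {k : ℕ} (hk : 1 ≤ k) {η : ℝ} (hη : 0 ≤ η) (x : InvSqrtSimplex k)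
    (a i : Fin k) :
    potential i (mirrorStep hk hη x a true) ≤
      potential i x - η + (if a = i then η * x.1 a ^ 2 else 0) + η ^ 2 * x.1 a := by
  have hxa := (x.pos a).ne'
  have h1 : η * x.1 a ^ 2 / x.1 a ^ 2 = η := by field_simp
  have h2 : (η * x.1 a ^ 2) ^ 2 / x.1 a ^ 3 = η ^ 2 * x.1 a := by field_simp
  simpa only [if_true, h1, h2] using potential_mirrorStep hk hη x a true i

lemma potential_mirrorStep_false {k : ℕ} (hk : 1 ≤ k) {η : ℝ} (hη : 0 ≤ η)
    (x : InvSqrtSimplex k) (a i : Fin k) :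
    potential i (mirrorStep hk hη x a false) ≤ potential i x := by
  simpa using potential_mirrorStep hk hη x a false i

lemma sum_potential_mirrorStep_le {k : ℕ} (hk : 1 ≤ k) {η : ℝ} (hη : 0 ≤ η)
    (x : InvSqrtSimplex k) (i : Fin k) (m g : Fin k → ℝ) (hm0 : ∀ a, 0 ≤ m a)
    (hm1 : ∀ a, m a ≤ 1) (hg : ∀ a, g a ≤ m a - m i) :
    ∑ a, 1 / x.1 a ^ 2 * (η * g a + (m a * potential i (mirrorStep hk hη x a true) +
      (1 - m a) * potential i (mirrorStep hk hη x a false))) ≤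
      potential i x + η ^ 2 * √(k : ℝ) := by
  have hterm : ∀ a, 1 / x.1 a ^ 2 * (η * g a + (m a * potential i (mirrorStep hk hη x a true) +
      (1 - m a) * potential i (mirrorStep hk hη x a false))) ≤
      (potential i x - η * m i) * (1 / x.1 a ^ 2) + (if a = i then η * m i else 0) +
        η ^ 2 * (1 / x.1 a) := by
    intro a
    have hxa := x.pos a
    have h1 := mul_le_mul_of_nonneg_left (potential_mirrorStep_true hk hη x a i) (hm0 a)
    have h2 := mul_le_mul_of_nonneg_left (potential_mirrorStep_false hk hη x a i)
      (sub_nonneg.2 (hm1 a))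
    have h3 := mul_le_mul_of_nonneg_left (hg a) hη
    have h4 : m a * (η ^ 2 * x.1 a) ≤ η ^ 2 * x.1 a :=
      mul_le_of_le_one_left (by positivity) (hm1 a)
    calc _ ≤ 1 / x.1 a ^ 2 * ((potential i x - η * m i) +
          (if a = i then m i * (η * x.1 a ^ 2) else 0) + η ^ 2 * x.1 a) := by
          refine mul_le_mul_of_nonneg_left ?_ (by positivity)
          by_cases hai : a = i
          · subst hai
            simp only [if_true] at h1 ⊢
            nlinarith
          · simp only [hai, if_false] at h1 ⊢
            nlinarith
      _ = _ := by
          split_ifs with hai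
          · field_simp
          · field_simp
            ring
  refine (Finset.sum_le_sum fun a _ => hterm a).trans ?_
  have hs := mul_le_mul_of_nonneg_left (sum_one_div_le_sqrt x) (sq_nonneg η)
  simp only [Finset.sum_add_distrib, ← Finset.mul_sum, x.2.2, Finset.sum_ite_eq',
    Finset.mem_univ, if_true]
  linarith

/-- The history in which each reward is replaced by the indicator that it is negative. -/
noncomputable def signHist {k t : ℕ} (h : Hist k t) : Fin t → Fin k × Bool :=
  fun s => ((h s).1, decide ((h s).2 < 0))

lemma measurable_signHist {k t : ℕ} : Measurable (signHist : Hist k t → _) := by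
  refine measurable_pi_lambda _ fun s => ?_
  refine (measurable_fst.comp (measurable_pi_apply s)).prodMk ?_
  have h : Measurable fun r : ℝ => decide (r < 0) :=
    measurable_to_bool (by
      have : (fun r : ℝ => decide (r < 0)) ⁻¹' {true} = Set.Iio 0 := by ext; simp
      rw [this]
      exact measurableSet_Iio)
  exact h.comp (measurable_snd.comp (measurable_pi_apply s))

/-- The state of mirror descent after a history of binary losses. -/
noncomputable def mirrorState {k : ℕ} (hk : 1 ≤ k) {η : ℝ} (hη : 0 ≤ η) :
    ∀ t : ℕ, (Fin t → Fin k × Bool) → InvSqrtSimplex k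
  | 0, _ => InvSqrtSimplex.uniform hk
  | t + 1, h => mirrorStep hk hη (mirrorState hk hη t (Fin.init h)) (h (Fin.last t)).1
      (h (Fin.last t)).2

lemma mirrorState_snoc {k : ℕ} (hk : 1 ≤ k) {η : ℝ} (hη : 0 ≤ η) {t : ℕ} (h : Hist k t)
    (a : Fin k) (r : ℝ) :
    mirrorState hk hη (t + 1) (signHist (Fin.snoc h (a, r) : Hist k (t + 1))) =
      mirrorStep hk hη (mirrorState hk hη t (signHist h)) a (decide (r < 0)) := by
  have h1 : Fin.init (signHist (Fin.snoc h (a, r) : Hist k (t + 1))) = signHist h := by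
    funext s
    simp [signHist, Fin.init]
  rw [mirrorState, h1]
  simp [signHist]

/-- The distribution on arms with weights `1 / x a ^ 2`. -/
noncomputable def InvSqrtSimplex.toMeasure {k : ℕ} (x : InvSqrtSimplex k) : Measure (Fin k) :=
  ∑ a, ENNReal.ofReal (1 / x.1 a ^ 2) • Measure.dirac a

lemma InvSqrtSimplex.lintegral_toMeasure {k : ℕ} (x : InvSqrtSimplex k) (f : Fin k → ENNReal) :
    ∫⁻ a, f a ∂x.toMeasure = ∑ a, ENNReal.ofReal (1 / x.1 a ^ 2) * f a := by
  simp [InvSqrtSimplex.toMeasure]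

instance {k : ℕ} (x : InvSqrtSimplex k) : IsProbabilityMeasure x.toMeasure := by
  constructor
  rw [← lintegral_one, x.lintegral_toMeasure]
  simp only [mul_one]
  rw [← ENNReal.ofReal_sum_of_nonneg (fun a _ => by positivity), x.2.2, ENNReal.ofReal_one]

/-- Mirror descent with the `1/2`-Tsallis entropy as a bandit policy. -/
noncomputable def mirrorPolicy {k : ℕ} (hk : 1 ≤ k) {η : ℝ} (hη : 0 ≤ η) : Policy k where
  act t h := (mirrorState hk hη t (signHist h)).toMeasure
  measurable_act t := (Measurable.of_discrete
    (f := fun d => (mirrorState hk hη t d).toMeasure)).comp measurable_signHist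
  prob_act _ _ := inferInstance

lemma measurable_snoc {k t : ℕ} (a : Fin k) :
    Measurable fun p : Hist k t × ℝ => (Fin.snoc p.1 (a, p.2) : Hist k (t + 1)) := by
  refine measurable_pi_lambda _ fun s => ?_
  refine Fin.lastCases ?_ (fun j => ?_) s
  · simpa using measurable_const.prodMk measurable_snd
  · simp only [Fin.snoc_castSucc]
    exact (measurable_pi_apply j).comp measurable_fst

lemma lintegral_traj_succ {k : ℕ} (θ : Fin k → ℝ) (π : Policy k) (t : ℕ)
    {f : Hist k (t + 1) → ENNReal} (hf : Measurable f) :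
    ∫⁻ h, f h ∂traj θ π.act (t + 1) =
      ∫⁻ h, ∫⁻ a, ∫⁻ r, f (Fin.snoc h (a, r)) ∂gaussianReal (θ a) 1 ∂π.act t h
        ∂traj θ π.act t := by
  have hsnoc : ∀ (h : Hist k t) (a : Fin k),
      Measurable fun r : ℝ => (Fin.snoc h (a, r) : Hist k (t + 1)) := fun h a =>
    (measurable_snoc a).comp measurable_prodMk_left
  have hstep : Measurable fun h : Hist k t => (π.act t h).bind fun a =>
      (gaussianReal (θ a) 1).map fun r => (Fin.snoc h (a, r) : Hist k (t + 1)) := by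
    refine Measure.measurable_of_measurable_coe _ fun s hs => ?_
    have heq : ∀ h : Hist k t, ((π.act t h).bind fun a =>
        (gaussianReal (θ a) 1).map fun r => (Fin.snoc h (a, r) : Hist k (t + 1))) s =
        ∑ a, gaussianReal (θ a) 1 (Prod.mk h ⁻¹'
          ((fun p : Hist k t × ℝ => (Fin.snoc p.1 (a, p.2) : Hist k (t + 1))) ⁻¹' s)) *
            π.act t h {a} := by
      intro h
      rw [Measure.bind_apply hs Measurable.of_discrete.aemeasurable, lintegral_fintype]
      refine Finset.sum_congr rfl fun a _ => ?_
      rw [Measure.map_apply (hsnoc h a) hs]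
      rfl
    simp only [heq]
    refine Finset.measurable_fun_sum _ fun a _ => ?_
    exact (measurable_measure_prodMk_left (measurable_snoc a hs)).mul
      ((Measure.measurable_coe (measurableSet_singleton a)).comp (π.measurable_act t))
  rw [traj, Measure.lintegral_bind hstep.aemeasurable hf.aemeasurable]
  refine lintegral_congr fun h => ?_
  rw [Measure.lintegral_bind Measurable.of_discrete.aemeasurable hf.aemeasurable]
  exact lintegral_congr fun a => lintegral_map hf (hsnoc h a)

lemma traj_univ {k : ℕ} (θ : Fin k → ℝ) (π : Policy k) (t : ℕ) :
    traj θ π.act t Set.univ = 1 := by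
  induction t with
  | zero => simp [traj]
  | succ t ih =>
    rw [← lintegral_one, lintegral_traj_succ θ π t measurable_const]
    have := π.prob_act t
    simp [ih]

lemma lintegral_decide_neg (μ : Measure ℝ) [IsProbabilityMeasure μ] (f : Bool → ℝ)
    (hf : ∀ b, 0 ≤ f b) :
    ∫⁻ r, ENNReal.ofReal (f (decide (r < 0))) ∂μ =
      ENNReal.ofReal (μ.real (Set.Iio 0) * f true + (1 - μ.real (Set.Iio 0)) * f false) := by
  have hle : μ.real (Set.Iio 0) ≤ 1 := measureReal_le_one
  have hcompl : μ (Set.Iio 0)ᶜ = ENNReal.ofReal (1 - μ.real (Set.Iio 0)) := by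
    rw [← probReal_compl_eq_one_sub measurableSet_Iio, ofReal_measureReal]
  rw [← lintegral_add_compl _ (measurableSet_Iio (a := (0 : ℝ))),
    setLIntegral_congr_fun (g := fun _ => ENNReal.ofReal (f true)) measurableSet_Iio
      (fun r hr => by simp [Set.mem_Iio.1 hr]),
    setLIntegral_congr_fun (g := fun _ => ENNReal.ofReal (f false)) measurableSet_Iio.compl
      (fun r hr => by
        have hr' : ¬r < 0 := hr
        simp only [hr', decide_false]),
    setLIntegral_const, setLIntegral_const, hcompl,
    ENNReal.ofReal_add (mul_nonneg measureReal_nonneg (hf _))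
      (mul_nonneg (sub_nonneg.2 hle) (hf _)),
    ENNReal.ofReal_mul measureReal_nonneg, ENNReal.ofReal_mul (sub_nonneg.2 hle),
    ofReal_measureReal, mul_comm, mul_comm (ENNReal.ofReal (f false))]

lemma gaussianReal_Iio_sub_ge {x y : ℝ} (hx : x ∈ Set.Icc (0 : ℝ) 1) (hy : y ∈ Set.Icc (0 : ℝ) 1)
    (hxy : x ≤ y) :
    gaussianPDFReal 0 1 1 * (y - x) ≤
      (gaussianReal x 1).real (Set.Iio 0) - (gaussianReal y 1).real (Set.Iio 0) := by
  have hshift : ∀ z : ℝ, (gaussianReal z 1).real (Set.Iio 0) =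
      (gaussianReal 0 1).real (Set.Iio (-z)) := by
    intro z
    have h := gaussianReal_map_add_const (μ := 0) (v := 1) z
    rw [zero_add] at h
    rw [← h, map_measureReal_apply (by fun_prop) measurableSet_Iio]
    congr 1
    ext r
    simp only [Set.mem_preimage, Set.mem_Iio]
    constructor <;> intro h <;> linarith
  have hsplit : Set.Iio (-y) ∪ Set.Ico (-y) (-x) = Set.Iio (-x) :=
    Set.Iio_union_Ico_eq_Iio (by linarith)
  have hdisj : Disjoint (Set.Iio (-y)) (Set.Ico (-y) (-x)) :=
    Set.disjoint_left.2 fun r hr hr' => absurd hr (not_lt.2 hr'.1)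
  rw [hshift, hshift, ← hsplit, measureReal_union hdisj measurableSet_Ico, add_sub_cancel_left]
  have hpdf : 0 ≤ gaussianPDFReal 0 1 1 := gaussianPDFReal_nonneg _ _ _
  refine (ENNReal.ofReal_le_iff_le_toReal (measure_ne_top _ _)).1 ?_
  rw [gaussianReal_apply _ one_ne_zero]
  calc ENNReal.ofReal (gaussianPDFReal 0 1 1 * (y - x))
      = ∫⁻ _ in Set.Ico (-y) (-x), gaussianPDF 0 1 1 := by
        rw [setLIntegral_const, Real.volume_Ico, ENNReal.ofReal_mul hpdf, gaussianPDF]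
        congr 2
        ring
    _ ≤ ∫⁻ r in Set.Ico (-y) (-x), gaussianPDF 0 1 r := by
        refine setLIntegral_mono' measurableSet_Ico fun r hr => ?_
        refine ENNReal.ofReal_le_ofReal ?_
        have h1 : r ^ 2 ≤ 1 := by nlinarith [hr.1, hr.2, hx.1, hy.2]
        refine mul_le_mul_of_nonneg_left (Real.exp_le_exp.2 ?_) (by positivity)
        simp only [sub_zero, NNReal.coe_one]
        linarith

/-- The rescaled regret against the arm `i` accumulated along a history of binary losses. -/
noncomputable def scaledRegret {k : ℕ} (η : ℝ) (θ : Fin k → ℝ) (i : Fin k) (t : ℕ)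
    (d : Fin t → Fin k × Bool) : ℝ :=
  η * ∑ s : Fin t, gaussianPDFReal 0 1 1 * (θ i - θ (d s).1)

lemma scaledRegret_nonneg {k : ℕ} {η : ℝ} (hη : 0 ≤ η) {θ : Fin k → ℝ} {i : Fin k}
    (hi : ∀ a, θ a ≤ θ i) (t : ℕ) (d : Fin t → Fin k × Bool) : 0 ≤ scaledRegret η θ i t d :=
  mul_nonneg hη (Finset.sum_nonneg fun _ _ =>
    mul_nonneg (gaussianPDFReal_nonneg _ _ _) (sub_nonneg.2 (hi _)))

lemma scaledRegret_snoc {k : ℕ} (η : ℝ) (θ : Fin k → ℝ) (i : Fin k) {t : ℕ} (h : Hist k t)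
    (a : Fin k) (r : ℝ) :
    scaledRegret η θ i (t + 1) (signHist (Fin.snoc h (a, r) : Hist k (t + 1))) =
      scaledRegret η θ i t (signHist h) + η * (gaussianPDFReal 0 1 1 * (θ i - θ a)) := by
  rw [scaledRegret, Fin.sum_univ_castSucc]
  simp [scaledRegret, signHist, mul_add]

lemma lintegral_mirrorPolicy_step_le {k : ℕ} (hk : 1 ≤ k) {η : ℝ} (hη : 0 ≤ η) {θ : Fin k → ℝ}
    (hθ : ∀ a, θ a ∈ Set.Icc (0 : ℝ) 1) {i : Fin k} (hi : ∀ a, θ a ≤ θ i)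
    (x : InvSqrtSimplex k) {V : ℝ} (hV : 0 ≤ V) :
    ∫⁻ a, ∫⁻ r, ENNReal.ofReal (V + η * (gaussianPDFReal 0 1 1 * (θ i - θ a)) +
        potential i (mirrorStep hk hη x a (decide (r < 0)))) ∂gaussianReal (θ a) 1 ∂x.toMeasure ≤
      ENNReal.ofReal (V + potential i x) + ENNReal.ofReal (η ^ 2 * √(k : ℝ)) := by
  set m : Fin k → ℝ := fun a => (gaussianReal (θ a) 1).real (Set.Iio 0) with hm
  set g : Fin k → ℝ := fun a => gaussianPDFReal 0 1 1 * (θ i - θ a) with hg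
  have hm0 : ∀ a, 0 ≤ m a := fun a => measureReal_nonneg
  have hm1 : ∀ a, m a ≤ 1 := fun a => measureReal_le_one
  have hgap : ∀ a, 0 ≤ η * g a := fun a =>
    mul_nonneg hη (mul_nonneg (gaussianPDFReal_nonneg _ _ _) (sub_nonneg.2 (hi a)))
  have hinner : ∀ a, ∫⁻ r, ENNReal.ofReal (V + η * g a +
        potential i (mirrorStep hk hη x a (decide (r < 0)))) ∂gaussianReal (θ a) 1 =
      ENNReal.ofReal (V + (η * g a + (m a * potential i (mirrorStep hk hη x a true) +
        (1 - m a) * potential i (mirrorStep hk hη x a false)))) := by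
    intro a
    rw [lintegral_decide_neg _ (fun b => V + η * g a + potential i (mirrorStep hk hη x a b))
      fun b => add_nonneg (add_nonneg hV (hgap a)) (potential_nonneg _ _)]
    congr 1
    simp only [hm]
    ring
  have hnn : ∀ a, 0 ≤ V + (η * g a + (m a * potential i (mirrorStep hk hη x a true) +
        (1 - m a) * potential i (mirrorStep hk hη x a false))) := fun a =>
    add_nonneg hV (add_nonneg (hgap a)
      (add_nonneg (mul_nonneg (hm0 a) (potential_nonneg _ _))
        (mul_nonneg (sub_nonneg.2 (hm1 a)) (potential_nonneg _ _))))
  have hkey := sum_potential_mirrorStep_le hk hη x i m g hm0 hm1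
    fun a => gaussianReal_Iio_sub_ge (hθ a) (hθ i) (hi a)
  rw [lintegral_congr hinner, x.lintegral_toMeasure,
    ← ENNReal.ofReal_add (add_nonneg hV (potential_nonneg _ _)) (by positivity)]
  have hw : ∀ a, 0 ≤ 1 / x.1 a ^ 2 := fun a => by positivity
  simp only [← ENNReal.ofReal_mul (hw _)]
  rw [← ENNReal.ofReal_sum_of_nonneg fun a _ => mul_nonneg (hw a) (hnn a)]
  refine ENNReal.ofReal_le_ofReal ?_
  simp only [mul_add _ V, Finset.sum_add_distrib, ← Finset.sum_mul, x.2.2]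
  linarith

lemma lintegral_traj_mirrorPolicy_le {k : ℕ} (hk : 1 ≤ k) {η : ℝ} (hη : 0 ≤ η) {θ : Fin k → ℝ}
    (hθ : ∀ a, θ a ∈ Set.Icc (0 : ℝ) 1) {i : Fin k} (hi : ∀ a, θ a ≤ θ i) (t : ℕ) :
    ∫⁻ h, ENNReal.ofReal (scaledRegret η θ i t (signHist h) +
        potential i (mirrorState hk hη t (signHist h))) ∂traj θ (mirrorPolicy hk hη).act t ≤
      ENNReal.ofReal (2 * √(k : ℝ) + t * (η ^ 2 * √(k : ℝ))) := by
  have hmeas : ∀ t : ℕ, Measurable fun h : Hist k t =>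
      ENNReal.ofReal (scaledRegret η θ i t (signHist h) +
        potential i (mirrorState hk hη t (signHist h))) := fun t =>
    (Measurable.of_discrete (f := fun d : Fin t → Fin k × Bool =>
      ENNReal.ofReal (scaledRegret η θ i t d +
        potential i (mirrorState hk hη t d)))).comp measurable_signHist
  induction t with
  | zero =>
    rw [traj, lintegral_dirac' _ (hmeas 0)]
    refine ENNReal.ofReal_le_ofReal ?_
    simpa [scaledRegret, mirrorState] using potential_uniform hk i
  | succ t ih =>
    rw [lintegral_traj_succ θ (mirrorPolicy hk hη) t (hmeas (t + 1))]
    simp only [scaledRegret_snoc, mirrorState_snoc]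
    refine (lintegral_mono fun h => lintegral_mirrorPolicy_step_le hk hη hθ hi
      (mirrorState hk hη t (signHist h)) (scaledRegret_nonneg hη hi t (signHist h))).trans ?_
    rw [lintegral_add_right _ measurable_const, lintegral_const, traj_univ, mul_one]
    refine (add_le_add_left ih _).trans_eq ?_
    rw [← ENNReal.ofReal_add (by positivity) (by positivity)]
    congr 1
    push_cast
    ring

lemma integral_regret_mirrorPolicy_le {k n : ℕ} (hk : 1 ≤ k) (hn : 1 ≤ n)
    {θ : Fin k → ℝ} (hθ : ∀ a, θ a ∈ Set.Icc (0 : ℝ) 1) :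
    ∫ h, (∑ t : Fin n, ((⨆ a, θ a) - θ (h t).1))
      ∂traj θ (mirrorPolicy hk (η := 1 / √(n : ℝ)) (by positivity)).act n ≤
      3 / gaussianPDFReal 0 1 1 * √(k * n) := by
  have : Nonempty (Fin k) := ⟨⟨0, hk⟩⟩
  obtain ⟨i, hi⟩ := Finite.exists_max θ
  have hsup : ⨆ a, θ a = θ i :=
    le_antisymm (ciSup_le hi) (le_ciSup (Set.finite_range θ).bddAbove i)
  have hη : 0 ≤ 1 / √(n : ℝ) := by positivity
  have hc : 0 < gaussianPDFReal 0 1 1 := gaussianPDFReal_pos _ _ _ one_ne_zero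
  have hn0 : 0 < √(n : ℝ) := Real.sqrt_pos.2 (by exact_mod_cast hn)
  have hbound := lintegral_traj_mirrorPolicy_le hk hη hθ hi n
  set μ := traj θ (mirrorPolicy hk hη).act n
  have hmeas : Measurable fun h : Hist k n => ∑ t : Fin n, (θ i - θ (h t).1) :=
    (Measurable.of_discrete (f := fun d : Fin n → Fin k × Bool =>
      ∑ t : Fin n, (θ i - θ (d t).1))).comp measurable_signHist
  have hnn : ∀ h : Hist k n, 0 ≤ ∑ t : Fin n, (θ i - θ (h t).1) := fun h =>
    Finset.sum_nonneg fun s _ => sub_nonneg.2 (hi _)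
  set c := 1 / √(n : ℝ) * gaussianPDFReal 0 1 1 with hcdef
  have hc0 : 0 < c := by positivity
  have hscaled : c * ∫ h, ∑ t : Fin n, (θ i - θ (h t).1) ∂μ ≤
      2 * √(k : ℝ) + n * ((1 / √(n : ℝ)) ^ 2 * √(k : ℝ)) := by
    rw [← integral_const_mul, integral_eq_lintegral_of_nonneg_ae
      (Filter.Eventually.of_forall fun h => mul_nonneg hc0.le (hnn h))
      (hmeas.const_mul c).aestronglyMeasurable]
    refine ENNReal.toReal_le_of_le_ofReal (by positivity) (le_trans ?_ hbound)
    refine lintegral_mono fun h => ENNReal.ofReal_le_ofReal ?_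
    rw [scaledRegret, ← Finset.mul_sum, ← mul_assoc]
    exact le_add_of_nonneg_right (potential_nonneg _ _)
  simp only [hsup]
  have hrhs : 2 * √(k : ℝ) + n * ((1 / √(n : ℝ)) ^ 2 * √(k : ℝ)) = 3 * √(k : ℝ) := by
    rw [div_pow, one_pow, Real.sq_sqrt (Nat.cast_nonneg n)]
    have : (n : ℝ) ≠ 0 := by positivity
    field_simp
    ring
  rw [hrhs] at hscaled
  have hfinal : c * (3 / gaussianPDFReal 0 1 1 * √(k * n)) = 3 * √(k : ℝ) := by
    rw [Real.sqrt_mul (Nat.cast_nonneg k), hcdef]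
    field_simp
  exact le_of_mul_le_mul_left (hscaled.trans_eq hfinal.symm) hc0

end Bandit

open Bandit in
/-- There is a universal constant `C > 0` such that for every `k ≥ 1`, `n ≥ 1` and every
prior probability distribution `Q` over `k`-armed bandit environments `θ ∈ [0,1]^k`,
some policy has Bayesian regret at most `C * √(k * n)`. -/
theorem prior_dependent_bayesian_regret_upper_bound :
    ∃ C : ℝ, 0 < C ∧
      ∀ k n : ℕ, 1 ≤ k → 1 ≤ n →
        ∀ Q : Measure (Fin k → ℝ), IsProbabilityMeasure Q →
          (∀ᵐ θ ∂Q, ∀ a, θ a ∈ Set.Icc (0 : ℝ) 1) →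
          ∃ π : Policy k, bayesRegret k n Q π.act ≤ C * Real.sqrt (k * n) := by
  have hc : 0 < gaussianPDFReal 0 1 1 := gaussianPDFReal_pos _ _ _ one_ne_zero
  refine ⟨3 / gaussianPDFReal 0 1 1, by positivity, fun k n hk hn Q hQ hθ => ?_⟩
  refine ⟨mirrorPolicy hk (η := 1 / √(n : ℝ)) (by positivity), ?_⟩
  have hle : ∀ θ : Fin k → ℝ, ∀ a, θ a ≤ ⨆ b, θ b := fun θ a =>
    le_ciSup (Set.finite_range θ).bddAbove a
  refine (integral_mono_of_nonneg (g := fun _ => 3 / gaussianPDFReal 0 1 1 * √(k * n))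
    (Filter.Eventually.of_forall fun θ => ?_) (integrable_const _) ?_).trans_eq (by simp)
  · exact integral_nonneg fun h => Finset.sum_nonneg fun t _ => sub_nonneg.2 (hle θ _)
  · filter_upwards [hθ] with θ hθ
    exact integral_regret_mirrorPolicy_le hk hn hθ
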